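/- arXiv:2212.06675 — 6 statements merged into one kernel-verified Lean document; each statement's English description precedes it below -/
import Mathlib

section
/- If Γ ⊢_CL M : σ in simply typed combinatory logic, then Γ ⊢ M : σ in the logic of combinatory logic LCL (viewing the declarations of Γ as LCL-formulas). -/
/- ## Syntax of combinatory logic -/

/-- CL-terms: variables, primitive combinators S, K, I, and application. -/
inductive CLTerm : Type
  | var : ℕ → CLTerm
  | S : CLTerm
  | K : CLTerm
  | I : CLTerm
  | app : CLTerm → CLTerm → CLTerm

/-- Simple types: type variables and arrow types. -/
inductive SType : Type
  | var : ℕ → SType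
  | arrow : SType → SType → SType

/-- The set of (free) variables occurring in a CL-term. -/
def CLTerm.FV : CLTerm → Set ℕ
  | .var x => {x}
  | .S => ∅
  | .K => ∅
  | .I => ∅
  | .app M N => M.FV ∪ N.FV

/-- Substitution `M{N/x}` of the term `N` for the variable `x` in `M`. -/
def CLTerm.subst : CLTerm → CLTerm → ℕ → CLTerm
  | .var y, N, x => if y = x then N else .var y
  | .S, _, _ => .S
  | .K, _, _ => .K
  | .I, _, _ => .I
  | .app P Q, N, x => .app (P.subst N x) (Q.subst N x)

/-- A basis is a set of declarations `(x, σ)` with distinct term variables as subjects. -/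
def IsBasis (Γ : Set (ℕ × SType)) : Prop :=
  ∀ ⦃x : ℕ⦄ ⦃σ τ : SType⦄, (x, σ) ∈ Γ → (x, τ) ∈ Γ → σ = τ

/-- The simply typed combinatory logic CL→ : `Γ ⊢_CL M : σ`. -/
inductive CLTyping : Set (ℕ × SType) → CLTerm → SType → Prop
  | var {Γ : Set (ℕ × SType)} {x : ℕ} {σ : SType} : (x, σ) ∈ Γ → CLTyping Γ (.var x) σ
  | S {Γ : Set (ℕ × SType)} (σ ρ τ : SType) :
      CLTyping Γ .S ((σ.arrow (ρ.arrow τ)).arrow ((σ.arrow ρ).arrow (σ.arrow τ)))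
  | K {Γ : Set (ℕ × SType)} (σ τ : SType) : CLTyping Γ .K (σ.arrow (τ.arrow σ))
  | I {Γ : Set (ℕ × SType)} (σ : SType) : CLTyping Γ .I (σ.arrow σ)
  | app {Γ : Set (ℕ × SType)} {M N : CLTerm} {σ τ : SType} : CLTyping Γ M (σ.arrow τ) → CLTyping Γ N σ → CLTyping Γ (M.app N) τ

/-- The extensional equational theory EQ^η of combinatory logic. -/
inductive EqEta : CLTerm → CLTerm → Prop
  | refl (M : CLTerm) : EqEta M M
  | Sred (M N L : CLTerm) : EqEta (((CLTerm.S.app M).app N).app L) ((M.app L).app (N.app L))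
  | Kred (M N : CLTerm) : EqEta ((CLTerm.K.app M).app N) M
  | Ired (M : CLTerm) : EqEta (CLTerm.I.app M) M
  | symm {M N : CLTerm} : EqEta M N → EqEta N M
  | trans {M N L : CLTerm} : EqEta M N → EqEta N L → EqEta M L
  | appL {M N : CLTerm} (P : CLTerm) : EqEta M N → EqEta (M.app P) (N.app P)
  | appR {M N : CLTerm} (P : CLTerm) : EqEta M N → EqEta (P.app M) (P.app N)
  | ext {M N : CLTerm} (x : ℕ) : EqEta (M.app (.var x)) (N.app (.var x)) →
      x ∉ M.FV ∪ N.FV → EqEta M N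

/-- The extended type assignment system CL=→ : CL→ plus the rule (eq). -/
inductive CLEqTyping : Set (ℕ × SType) → CLTerm → SType → Prop
  | var {Γ : Set (ℕ × SType)} {x : ℕ} {σ : SType} : (x, σ) ∈ Γ → CLEqTyping Γ (.var x) σ
  | S {Γ : Set (ℕ × SType)} (σ ρ τ : SType) :
      CLEqTyping Γ .S ((σ.arrow (ρ.arrow τ)).arrow ((σ.arrow ρ).arrow (σ.arrow τ)))
  | K {Γ : Set (ℕ × SType)} (σ τ : SType) : CLEqTyping Γ .K (σ.arrow (τ.arrow σ))
  | I {Γ : Set (ℕ × SType)} (σ : SType) : CLEqTyping Γ .I (σ.arrow σ)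
  | app {Γ : Set (ℕ × SType)} {M N : CLTerm} {σ τ : SType} : CLEqTyping Γ M (σ.arrow τ) → CLEqTyping Γ N σ → CLEqTyping Γ (M.app N) τ
  | eq {Γ : Set (ℕ × SType)} {M N : CLTerm} {σ : SType} : CLEqTyping Γ M σ → EqEta M N → CLEqTyping Γ N σ

/- ## LCL formulas and the axiomatic system -/

/-- Raw formulas of LCL: atomic type-assignment statements `M : σ`, negation, implication. -/
inductive LCLForm : Type
  | stm : CLTerm → SType → LCLForm
  | neg : LCLForm → LCLForm
  | imp : LCLForm → LCLForm → LCLForm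

/-- A raw formula is a genuine LCL-formula when each atomic statement `M : σ`
occurring in it is derivable from some basis in CL→. -/
def LCLForm.WF : LCLForm → Prop
  | .stm M σ => ∃ Γ : Set (ℕ × SType), IsBasis Γ ∧ CLTyping Γ M σ
  | .neg α => α.WF
  | .imp α β => α.WF ∧ β.WF

/-- The axiom schemes (Ax1)–(Ax8) of LCL. -/
inductive LCLAx : LCLForm → Prop
  | ax1 (σ τ ρ : SType) :
      LCLAx (.stm .S ((σ.arrow (τ.arrow ρ)).arrow ((σ.arrow τ).arrow (σ.arrow ρ))))
  | ax2 (σ τ : SType) : LCLAx (.stm .K (σ.arrow (τ.arrow σ)))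
  | ax3 (σ : SType) : LCLAx (.stm .I (σ.arrow σ))
  | ax4 {M N : CLTerm} {σ τ : SType} :
      (LCLForm.stm M (σ.arrow τ)).WF → (LCLForm.stm N σ).WF → (LCLForm.stm (M.app N) τ).WF →
      LCLAx ((LCLForm.stm M (σ.arrow τ)).imp ((LCLForm.stm N σ).imp (.stm (M.app N) τ)))
  | ax5 {M N : CLTerm} {σ : SType} :
      EqEta M N → (LCLForm.stm M σ).WF → (LCLForm.stm N σ).WF →
      LCLAx ((LCLForm.stm M σ).imp (.stm N σ))
  | ax6 {α β : LCLForm} : α.WF → β.WF → LCLAx (α.imp (β.imp α))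
  | ax7 {α β γ : LCLForm} : α.WF → β.WF → γ.WF →
      LCLAx ((α.imp (β.imp γ)).imp ((α.imp β).imp (α.imp γ)))
  | ax8 {α β : LCLForm} : α.WF → β.WF →
      LCLAx ((α.neg.imp β.neg).imp ((α.neg.imp β).imp α))

/-- Derivability `T ⊢ α` in LCL: axioms, hypotheses, and Modus Ponens. -/
inductive LCLDeriv (T : Set LCLForm) : LCLForm → Prop
  | ax {α : LCLForm} : LCLAx α → LCLDeriv T α
  | hyp {α : LCLForm} : α ∈ T → LCLDeriv T α
  | mp {α β : LCLForm} : LCLDeriv T (α.imp β) → LCLDeriv T α → LCLDeriv T β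

/-- `T` is consistent if some LCL-formula is not derivable from `T`. -/
def LCLConsistent (T : Set LCLForm) : Prop :=
  ∃ α : LCLForm, α.WF ∧ ¬ LCLDeriv T α

/-- `T` is maximal consistent if it is consistent and contains `α` or `¬α`
for every LCL-formula `α`. -/
def LCLMaxConsistent (T : Set LCLForm) : Prop :=
  LCLConsistent T ∧ ∀ α : LCLForm, α.WF → (α ∈ T ∨ α.neg ∈ T)

/-- The set of LCL-formulas corresponding to the declarations of a basis. -/
def basisForms (Γ : Set (ℕ × SType)) : Set LCLForm :=
  (fun p => LCLForm.stm (CLTerm.var p.1) p.2) '' Γ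

/- ## Semantics -/

universe u

/-- An applicative structure for LCL. -/
structure AppStruct : Type (u + 1) where
  D : Type u
  nonempty : Nonempty D
  A : SType → Set D
  app : D → D → D
  ext : ∀ d₁ d₂ : D, (∀ e : D, app d₁ e = app d₂ e) → d₁ = d₂
  app_mem : ∀ {σ τ : SType} {d e : D}, d ∈ A (σ.arrow τ) → e ∈ A σ → app d e ∈ A τ
  s : D
  k : D
  i : D
  s_mem : ∀ σ τ ρ : SType,
    s ∈ A ((σ.arrow (τ.arrow ρ)).arrow ((σ.arrow τ).arrow (σ.arrow ρ)))
  s_app : ∀ d e f : D, app (app (app s d) e) f = app (app d f) (app e f)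
  k_mem : ∀ σ τ : SType, k ∈ A (σ.arrow (τ.arrow σ))
  k_app : ∀ d e : D, app (app k d) e = d
  i_mem : ∀ σ : SType, i ∈ A (σ.arrow σ)
  i_app : ∀ d : D, app i d = d

/-- The interpretation `⟦M⟧_ρ` of a CL-term in an applicative structure
with environment `ρ`. -/
def interpTerm (𝒜 : AppStruct.{u}) (ρ : ℕ → 𝒜.D) : CLTerm → 𝒜.D
  | .var x => ρ x
  | .S => 𝒜.s
  | .K => 𝒜.k
  | .I => 𝒜.i
  | .app M N => 𝒜.app (interpTerm 𝒜 ρ M) (interpTerm 𝒜 ρ N)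

/-- Satisfaction of an LCL-formula in an LCL-model `⟨𝒜, ρ⟩`. -/
def LCLSat (𝒜 : AppStruct.{u}) (ρ : ℕ → 𝒜.D) : LCLForm → Prop
  | .stm M σ => interpTerm 𝒜 ρ M ∈ 𝒜.A σ
  | .neg α => ¬ LCLSat 𝒜 ρ α
  | .imp α β => LCLSat 𝒜 ρ α → LCLSat 𝒜 ρ β

/-- Semantical consequence `T ⊨ α`. -/
def LCLSemCons (T : Set LCLForm) (α : LCLForm) : Prop :=
  ∀ (𝒜 : AppStruct.{u}) (ρ : ℕ → 𝒜.D), (∀ β ∈ T, LCLSat 𝒜 ρ β) → LCLSat 𝒜 ρ α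

/- ## The canonical (term) model -/

instance CLTerm.setoid : Setoid CLTerm :=
  ⟨EqEta, ⟨EqEta.refl, fun h => h.symm, fun h h' => h.trans h'⟩⟩

/-- EQ^η-equivalence classes of CL-terms. -/
abbrev CLQuot : Type := Quotient CLTerm.setoid

theorem EqEta.app_congr {M N P Q : CLTerm} (h1 : EqEta M P) (h2 : EqEta N Q) :
    EqEta (M.app N) (P.app Q) := (EqEta.appL N h1).trans (EqEta.appR P h2)

/-- Application on equivalence classes: `[M]·[N] = [M N]`. -/
def canonApp : CLQuot → CLQuot → CLQuot :=
  Quotient.map₂ CLTerm.app (fun _ _ h1 _ _ h2 => EqEta.app_congr h1 h2)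

/-- The canonical interpretation of a CL-term in the term model with
environment `ρ*(x) = [x]` : it satisfies `⟦M⟧_{ρ*} = [M]`. -/
def canonInterp : CLTerm → CLQuot
  | .var x => ⟦.var x⟧
  | .S => ⟦.S⟧
  | .K => ⟦.K⟧
  | .I => ⟦.I⟧
  | .app M N => canonApp (canonInterp M) (canonInterp N)

/-- The canonical sets `A^σ = { [M] | M : σ ∈ T }` determined by a set of formulas. -/
def canonA (T : Set LCLForm) (σ : SType) : Set CLQuot :=
  {q | ∃ M : CLTerm, (⟦M⟧ : CLQuot) = q ∧ LCLForm.stm M σ ∈ T}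

/-- The sets `A^σ = { [M] | Γ ⊢_{CL=} M : σ }` determined by a basis. -/
def canonAGamma (Γ : Set (ℕ × SType)) (σ : SType) : Set CLQuot :=
  {q | ∃ M : CLTerm, (⟦M⟧ : CLQuot) = q ∧ CLEqTyping Γ M σ}

/-- Satisfaction in the canonical model `⟨M_{T}, ρ*⟩` with `ρ*(x) = [x]`. -/
def canonSat (T : Set LCLForm) : LCLForm → Prop
  | .stm M σ => canonInterp M ∈ canonA T σ
  | .neg α => ¬ canonSat T α
  | .imp α β => canonSat T α → canonSat T β

/-- Derivability in CL→ implies derivability in LCL. -/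
theorem cl_to_lcl (Γ : Set (ℕ × SType)) (hΓ : IsBasis Γ) (M : CLTerm) (σ : SType)
    (h : CLTyping Γ M σ) :
    LCLDeriv (basisForms Γ) (.stm M σ) := by
  induction h with
  | var hx => exact .hyp ⟨_, hx, rfl⟩
  | S σ ρ τ => exact .ax (.ax1 σ ρ τ)
  | K σ τ => exact .ax (.ax2 σ τ)
  | I σ => exact .ax (.ax3 σ)
  | app hM hN ihM ihN =>
    exact .mp (.mp (.ax (.ax4 ⟨_, hΓ, hM⟩ ⟨_, hΓ, hN⟩ ⟨_, hΓ, .app hM hN⟩)) ihM) ihN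
end

section
/- Completeness of the equational theory EQ^η: if ⟦M⟧_ρ = ⟦N⟧_ρ in every LCL-model M_ρ = ⟨M, ρ⟩, then M = N is provable in EQ^η. -/
/- ## Semantics -/

universe u

theorem CLTerm.finite_FV (M : CLTerm) : M.FV.Finite := by
  induction M with
  | var x => exact Set.finite_singleton x
  | S | K | I => exact Set.finite_empty
  | app M N hM hN => exact hM.union hN

theorem EqEta.of_forall_app {M N : CLTerm} (h : ∀ P, EqEta (M.app P) (N.app P)) :
    EqEta M N := by
  obtain ⟨x, hx⟩ := (M.finite_FV.union N.finite_FV).exists_notMem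
  exact EqEta.ext x (h _) hx

/-- The structure on EQ^η-equivalence classes, typed from a basis by CL=→ and lifted to an
arbitrary universe. -/
def termStruct (Γ : Set (ℕ × SType)) : AppStruct.{u} where
  D := ULift.{u} CLQuot
  nonempty := ⟨⟨⟦.I⟧⟩⟩
  A σ := {d | d.down ∈ canonAGamma Γ σ}
  app d e := ⟨canonApp d.down e.down⟩
  ext := by
    rintro ⟨⟨M⟩⟩ ⟨⟨N⟩⟩ h
    refine congrArg ULift.up (Quotient.sound (EqEta.of_forall_app fun P => ?_))
    exact Quotient.exact (congrArg ULift.down (h ⟨⟦P⟧⟩))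
  app_mem := by
    rintro σ τ ⟨_⟩ ⟨_⟩ ⟨M, rfl, hM⟩ ⟨N, rfl, hN⟩
    exact ⟨M.app N, rfl, hM.app hN⟩
  s := ⟨⟦.S⟧⟩
  k := ⟨⟦.K⟧⟩
  i := ⟨⟦.I⟧⟩
  s_mem σ τ ρ := ⟨.S, rfl, .S σ τ ρ⟩
  s_app := by
    rintro ⟨⟨M⟩⟩ ⟨⟨N⟩⟩ ⟨⟨L⟩⟩
    exact congrArg ULift.up (Quotient.sound (EqEta.Sred M N L))
  k_mem σ τ := ⟨.K, rfl, .K σ τ⟩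
  k_app := by
    rintro ⟨⟨M⟩⟩ ⟨⟨N⟩⟩
    exact congrArg ULift.up (Quotient.sound (EqEta.Kred M N))
  i_mem σ := ⟨.I, rfl, .I σ⟩
  i_app := by
    rintro ⟨⟨M⟩⟩
    exact congrArg ULift.up (Quotient.sound (EqEta.Ired M))

theorem interpTerm_termStruct (Γ : Set (ℕ × SType)) (M : CLTerm) :
    interpTerm (termStruct.{u} Γ) (fun x => ⟨⟦.var x⟧⟩) M = ⟨⟦M⟧⟩ := by
  induction M with
  | var | S | K | I => rfl
  | app M N hM hN => exact congrArg₂ (termStruct Γ).app hM hN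

/-- Completeness of the equational theory EQ^η. -/
theorem eqEta_completeness (M N : CLTerm)
    (h : ∀ (𝒜 : AppStruct.{u}) (ρ : ℕ → 𝒜.D), interpTerm 𝒜 ρ M = interpTerm 𝒜 ρ N) :
    EqEta M N := by
  have hMN := h (termStruct.{u} ∅) (fun x => ⟨⟦.var x⟧⟩)
  rw [interpTerm_termStruct, interpTerm_termStruct] at hMN
  exact Quotient.exact (congrArg ULift.down hMN)
end

section
/- Soundness of LCL: for any set T of LCL-formulas and any LCL-formula α, if T ⊢ α then T ⊨ α. -/
/- ## Semantics -/

universe u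

/-- The interpretation of a term depends only on the values of its free variables. -/
theorem interpTerm_congr {𝒜 : AppStruct.{u}} {ρ ρ' : ℕ → 𝒜.D} {M : CLTerm}
    (h : ∀ x ∈ M.FV, ρ x = ρ' x) : interpTerm 𝒜 ρ M = interpTerm 𝒜 ρ' M := by
  induction M with
  | var x => exact h x rfl
  | S => rfl
  | K => rfl
  | I => rfl
  | app M N ihM ihN =>
    exact congrArg₂ 𝒜.app (ihM fun x hx => h x (Or.inl hx)) (ihN fun x hx => h x (Or.inr hx))

theorem interpTerm_update_of_notMem {𝒜 : AppStruct.{u}} (ρ : ℕ → 𝒜.D) {M : CLTerm} {x : ℕ}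
    (hx : x ∉ M.FV) (d : 𝒜.D) :
    interpTerm 𝒜 (Function.update ρ x d) M = interpTerm 𝒜 ρ M := by
  refine interpTerm_congr fun y hy => Function.update_of_ne (β := fun _ => 𝒜.D) ?_ d ρ
  rintro rfl
  exact hx hy

/-- Provably equal terms have the same interpretation. -/
theorem EqEta.interpTerm_eq {M N : CLTerm} (h : EqEta M N) (𝒜 : AppStruct.{u}) (ρ : ℕ → 𝒜.D) :
    interpTerm 𝒜 ρ M = interpTerm 𝒜 ρ N := by
  induction h generalizing ρ with
  | refl => rfl
  | Sred => exact 𝒜.s_app _ _ _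
  | Kred => exact 𝒜.k_app _ _
  | Ired => exact 𝒜.i_app _
  | symm _ ih => exact (ih ρ).symm
  | trans _ _ ih₁ ih₂ => exact (ih₁ ρ).trans (ih₂ ρ)
  | appL P _ ih => exact congrArg (𝒜.app · (interpTerm 𝒜 ρ P)) (ih ρ)
  | appR P _ ih => exact congrArg (𝒜.app (interpTerm 𝒜 ρ P)) (ih ρ)
  | ext x _ hx ih =>
    refine 𝒜.ext _ _ fun d => ?_
    simpa [interpTerm, interpTerm_update_of_notMem ρ (fun h => hx (Or.inl h)),
      interpTerm_update_of_notMem ρ (fun h => hx (Or.inr h))] using ih (Function.update ρ x d)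

/-- Every axiom of LCL holds in every model. -/
theorem LCLAx.sat {α : LCLForm} (h : LCLAx α) (𝒜 : AppStruct.{u}) (ρ : ℕ → 𝒜.D) :
    LCLSat 𝒜 ρ α := by
  cases h with
  | ax1 => exact 𝒜.s_mem _ _ _
  | ax2 => exact 𝒜.k_mem _ _
  | ax3 => exact 𝒜.i_mem _
  | ax4 => exact fun hM hN => 𝒜.app_mem hM hN
  | ax5 h =>
    simp only [LCLSat, h.interpTerm_eq 𝒜 ρ]
    exact id
  | ax6 => exact fun ha _ => ha
  | ax7 => exact fun habc hab ha => habc ha (hab ha)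
  | ax8 => exact fun h₁ h₂ => by_contra fun hn => h₁ hn (h₂ hn)

/-- Soundness of LCL. -/
theorem lcl_soundness (T : Set LCLForm) (α : LCLForm)
    (hT : ∀ γ ∈ T, γ.WF) (hα : α.WF)
    (h : LCLDeriv T α) :
    LCLSemCons T α := by
  clear hα
  intro 𝒜 ρ hsat
  induction h with
  | ax h => exact h.sat 𝒜 ρ
  | hyp h => exact hsat _ h
  | mp _ _ ih₁ ih₂ => exact ih₁ ih₂
end

section
/- Truth lemma: let T* be a maximal consistent set of LCL-formulas and M_{T*,ρ*} the canonical model with environment ρ*(x) = [x]. Then for every LCL-formula α, M_{T*,ρ*} ⊨ α if and only if α ∈ T*. -/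
/- ## Semantics -/

universe u

theorem canonInterp_eq (M : CLTerm) : canonInterp M = ⟦M⟧ := by
  induction M with
  | app M N ihM ihN => rw [canonInterp, ihM, ihN]; rfl
  | _ => rfl

namespace LCLDeriv

variable {T : Set LCLForm} {α β γ : LCLForm}

theorem imp_of_right (hα : α.WF) (hβ : β.WF) (h : LCLDeriv T β) : LCLDeriv T (α.imp β) :=
  (LCLDeriv.ax (LCLAx.ax6 hβ hα)).mp h

theorem imp_trans (hα : α.WF) (hβ : β.WF) (hγ : γ.WF) (h₁ : LCLDeriv T (α.imp β))
    (h₂ : LCLDeriv T (β.imp γ)) : LCLDeriv T (α.imp γ) :=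
  ((LCLDeriv.ax (LCLAx.ax7 hα hβ hγ)).mp (imp_of_right hα ⟨hβ, hγ⟩ h₂)).mp h₁

theorem imp_of_neg (hα : α.WF) (hβ : β.WF) (h : LCLDeriv T α.neg) : LCLDeriv T (α.imp β) :=
  have hβn : β.neg.WF := hβ
  imp_trans (β := β.neg.imp α) hα ⟨hβn, hα⟩ hβ (LCLDeriv.ax (LCLAx.ax6 hα hβn))
    ((LCLDeriv.ax (LCLAx.ax8 hβ hα)).mp (imp_of_right hβn hα h))

end LCLDeriv

namespace LCLMaxConsistent

variable {T : Set LCLForm} {α β : LCLForm}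

theorem not_deriv_neg (h : LCLMaxConsistent T) (hα : α.WF) (hd : LCLDeriv T α) :
    ¬ LCLDeriv T α.neg := by
  obtain ⟨⟨β, hβ, hnd⟩, -⟩ := h
  exact fun hn => hnd ((LCLDeriv.imp_of_neg hα hβ hn).mp hd)

theorem mem_of_deriv (h : LCLMaxConsistent T) (hα : α.WF) (hd : LCLDeriv T α) : α ∈ T :=
  (h.2 α hα).resolve_right fun hn => h.not_deriv_neg hα hd (.hyp hn)

theorem neg_mem_iff (h : LCLMaxConsistent T) (hα : α.WF) : α.neg ∈ T ↔ α ∉ T :=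
  ⟨fun hn hp => h.not_deriv_neg hα (.hyp hp) (.hyp hn), (h.2 α hα).resolve_left⟩

theorem imp_mem_iff (h : LCLMaxConsistent T) (hα : α.WF) (hβ : β.WF) :
    α.imp β ∈ T ↔ (α ∈ T → β ∈ T) := by
  refine ⟨fun hi hp => h.mem_of_deriv hβ ((LCLDeriv.hyp hi).mp (.hyp hp)), fun hi => ?_⟩
  refine h.mem_of_deriv ⟨hα, hβ⟩ ?_
  rcases h.2 α hα with hp | hn
  · exact LCLDeriv.imp_of_right hα hβ (.hyp (hi hp))
  · exact LCLDeriv.imp_of_neg hα hβ (.hyp hn)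

end LCLMaxConsistent

/-- Truth lemma for the canonical model. -/
theorem truth_lemma (T : Set LCLForm) (hT : ∀ γ ∈ T, γ.WF)
    (hmax : LCLMaxConsistent T) (α : LCLForm) (hα : α.WF) :
    canonSat T α ↔ α ∈ T := by
  induction α with
  | stm M σ =>
    rw [canonSat, canonInterp_eq]
    refine ⟨?_, fun h => ⟨M, rfl, h⟩⟩
    rintro ⟨N, hNM, hN⟩
    exact hmax.mem_of_deriv hα
      ((LCLDeriv.ax (LCLAx.ax5 (Quotient.exact hNM) (hT _ hN) hα)).mp (.hyp hN))
  | neg α ih => rw [canonSat, ih hα, hmax.neg_mem_iff (α := α) hα]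
  | imp α β ihα ihβ => rw [canonSat, ihα hα.1, ihβ hα.2, hmax.imp_mem_iff hα.1 hα.2]
end

section
/- For any basis Γ, the tuple M^Γ (with domain the EQ^η-equivalence classes of CL-terms, A^σ = { [M] | Γ ⊢_{CL=} M : σ }, application [M]·[N] = [MN], s = [S], k = [K], i = [I]) is an applicative structure for LCL, and for the environment ρ*(x) = [x] the resulting model satisfies: M^Γ_{ρ*} ⊨ M : σ if and only if Γ ⊢_{CL=} M : σ. -/
/- ## Semantics -/

universe u

/-- The canonical interpretation of a term is its equivalence class. -/
theorem canonInterp_eq_mk (M : CLTerm) : canonInterp M = (⟦M⟧ : CLQuot) := by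
  induction M with
  | app M N ihM ihN => rw [canonInterp, ihM, ihN]; rfl
  | _ => rfl

/-- A class belongs to `A^σ` iff any of its representatives has type `σ`. -/
theorem mk_mem_canonAGamma {Γ : Set (ℕ × SType)} {M : CLTerm} {σ : SType} :
    (⟦M⟧ : CLQuot) ∈ canonAGamma Γ σ ↔ CLEqTyping Γ M σ :=
  ⟨fun ⟨_, hNM, hN⟩ => hN.eq (Quotient.exact hNM), fun h => ⟨M, rfl, h⟩⟩

/-- Application on equivalence classes is extensional. -/
theorem canonApp_ext {d₁ d₂ : CLQuot} (h : ∀ e : CLQuot, canonApp d₁ e = canonApp d₂ e) :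
    d₁ = d₂ := by
  induction d₁, d₂ using Quotient.inductionOn₂ with
  | h M N =>
    obtain ⟨x, hx⟩ := (M.finite_FV.union N.finite_FV).exists_notMem
    exact Quotient.sound (EqEta.ext x (Quotient.exact (h ⟦.var x⟧)) hx)

/-- The term structure M^Γ is an applicative structure for LCL,
and in the model with environment ρ*(x) = [x] (so that ⟦M⟧_{ρ*} = [M]),
a statement M : σ is satisfied iff Γ ⊢_{CL=} M : σ. -/
theorem canonical_structure_basis (Γ : Set (ℕ × SType)) (hΓ : IsBasis Γ) :
    -- application is extensional
    (∀ d₁ d₂ : CLQuot, (∀ e : CLQuot, canonApp d₁ e = canonApp d₂ e) → d₁ = d₂) ∧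
    -- application maps A^{σ→τ} × A^σ into A^τ
    (∀ (σ τ : SType) (d e : CLQuot),
      d ∈ canonAGamma Γ (σ.arrow τ) → e ∈ canonAGamma Γ σ → canonApp d e ∈ canonAGamma Γ τ) ∧
    -- [S] satisfies the required membership and equational conditions
    (∀ σ τ ρ : SType, (⟦CLTerm.S⟧ : CLQuot) ∈
      canonAGamma Γ ((σ.arrow (τ.arrow ρ)).arrow ((σ.arrow τ).arrow (σ.arrow ρ)))) ∧
    (∀ d e f : CLQuot,
      canonApp (canonApp (canonApp ⟦CLTerm.S⟧ d) e) f = canonApp (canonApp d f) (canonApp e f)) ∧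
    -- [K] satisfies the required membership and equational conditions
    (∀ σ τ : SType, (⟦CLTerm.K⟧ : CLQuot) ∈ canonAGamma Γ (σ.arrow (τ.arrow σ))) ∧
    (∀ d e : CLQuot, canonApp (canonApp ⟦CLTerm.K⟧ d) e = d) ∧
    -- [I] satisfies the required membership and equational conditions
    (∀ σ : SType, (⟦CLTerm.I⟧ : CLQuot) ∈ canonAGamma Γ (σ.arrow σ)) ∧
    (∀ d : CLQuot, canonApp ⟦CLTerm.I⟧ d = d) ∧
    -- satisfaction in the resulting model characterizes CL=→-derivability
    (∀ (M : CLTerm) (σ : SType), canonInterp M ∈ canonAGamma Γ σ ↔ CLEqTyping Γ M σ) := by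
  refine ⟨fun _ _ => canonApp_ext, ?_, fun σ τ ρ => mk_mem_canonAGamma.2 (.S σ τ ρ), ?_,
    fun σ τ => mk_mem_canonAGamma.2 (.K σ τ), ?_, fun σ => mk_mem_canonAGamma.2 (.I σ), ?_,
    fun M σ => by rw [canonInterp_eq_mk, mk_mem_canonAGamma]⟩
  · rintro σ τ _ _ ⟨M, rfl, hM⟩ ⟨N, rfl, hN⟩
    exact ⟨M.app N, rfl, hM.app hN⟩
  · rintro ⟨M⟩ ⟨N⟩ ⟨L⟩
    exact Quotient.sound (EqEta.Sred M N L)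
  · rintro ⟨M⟩ ⟨N⟩
    exact Quotient.sound (EqEta.Kred M N)
  · rintro ⟨M⟩
    exact Quotient.sound (EqEta.Ired M)
end

section
/- LCL is a conservative extension of simply typed combinatory logic: for any basis Γ, if Γ ⊢ M : σ in LCL, then Γ ⊢_{CL=} M : σ in the extended type assignment system CL=→ (and conversely derivability in CL→ implies derivability in LCL). -/
/- ## Semantics -/

universe u

/-- Truth of an LCL-formula when `M : σ` is read as derivability of `M : σ` from `Γ` in CL=→. -/
def LCLForm.Holds (Γ : Set (ℕ × SType)) : LCLForm → Prop
  | .stm M σ => CLEqTyping Γ M σ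
  | .neg α => ¬ α.Holds Γ
  | .imp α β => α.Holds Γ → β.Holds Γ

theorem LCLAx.holds {α : LCLForm} (h : LCLAx α) (Γ : Set (ℕ × SType)) : α.Holds Γ := by
  cases h with
  | ax1 σ τ ρ => exact .S σ τ ρ
  | ax2 σ τ => exact .K σ τ
  | ax3 σ => exact .I σ
  | ax4 => exact fun hM hN => CLEqTyping.app hM hN
  | ax5 hMN => exact fun hM => CLEqTyping.eq hM hMN
  | ax6 => exact fun hα _ => hα
  | ax7 => exact fun hαβγ hαβ hα => hαβγ hα (hαβ hα)
  | ax8 => exact fun h₁ h₂ => by_contra fun hα => h₁ hα (h₂ hα)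

theorem LCLDeriv.holds {Γ : Set (ℕ × SType)} {T : Set LCLForm} (hT : ∀ α ∈ T, α.Holds Γ)
    {α : LCLForm} (h : LCLDeriv T α) : α.Holds Γ := by
  induction h with
  | ax hα => exact hα.holds Γ
  | hyp hα => exact hT _ hα
  | mp _ _ ih₁ ih₂ => exact ih₁ ih₂

theorem holds_of_mem_basisForms {Γ : Set (ℕ × SType)} : ∀ α ∈ basisForms Γ, α.Holds Γ := by
  rintro _ ⟨p, hp, rfl⟩
  exact CLEqTyping.var hp

theorem CLTyping.lclDeriv {Γ : Set (ℕ × SType)} (hΓ : IsBasis Γ) {M : CLTerm} {σ : SType}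
    (h : CLTyping Γ M σ) : LCLDeriv (basisForms Γ) (.stm M σ) := by
  induction h with
  | var hx => exact .hyp ⟨_, hx, rfl⟩
  | S σ ρ τ => exact .ax (.ax1 σ ρ τ)
  | K σ τ => exact .ax (.ax2 σ τ)
  | I σ => exact .ax (.ax3 σ)
  | app hM hN ihM ihN =>
    exact .mp (.mp (.ax (.ax4 ⟨_, hΓ, hM⟩ ⟨_, hΓ, hN⟩ ⟨_, hΓ, hM.app hN⟩)) ihM) ihN

/-- LCL is a conservative extension of simply typed combinatory
logic: LCL-derivability of M : σ from Γ implies Γ ⊢_{CL=} M : σ, and conversely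
Γ ⊢_CL M : σ implies LCL-derivability of M : σ from Γ. -/
theorem lcl_conservative_extension (Γ : Set (ℕ × SType)) (hΓ : IsBasis Γ)
    (M : CLTerm) (σ : SType) :
    (LCLDeriv (basisForms Γ) (.stm M σ) → CLEqTyping Γ M σ) ∧
    (CLTyping Γ M σ → LCLDeriv (basisForms Γ) (.stm M σ)) := by
  exact ⟨fun h => h.holds holds_of_mem_basisForms, CLTyping.lclDeriv hΓ⟩
end
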